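/- Let α > 1. For an irrational number x ∈ (0,1) let a₁(x), a₂(x), … ∈ ℕ (each ≥ 1) be the partial quotients of its regular continued fraction expansion x = [0; a₁(x), a₂(x), …]. Define Y_α := { x ∈ (0,1) irrational : Σ_{i=1}^{n} a_i(x) < n·α for every n ≥ 1 } and X_α := { x ∈ (0,1) irrational : limsup_{n→∞} (1/n)·Σ_{i=1}^{n} a_i(x) < α }. Then the Hausdorff dimensions coincide: dim_H X_α = dim_H Y_α; moreover this common value tends to 1 as α → ∞. -/

import Mathlib

/-- The Gauss map `G(x) = {1/x}` (fractional part of `1/x`). -/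
noncomputable def gaussMap (x : ℝ) : ℝ := Int.fract x⁻¹

/-- The `(i+1)`-st partial quotient of the regular continued fraction expansion of `x`:
`a_{i+1}(x) = ⌊1 / G^i(x)⌋` (so `cfPQ x 0 = a₁(x)`, `cfPQ x 1 = a₂(x)`, …). -/
noncomputable def cfPQ (x : ℝ) (i : ℕ) : ℕ := ⌊(gaussMap^[i] x)⁻¹⌋₊

/-- `Y_α` : irrationals `x ∈ (0,1)` whose partial quotients satisfy
`a₁(x) + ⋯ + a_n(x) < n·α` for every `n ≥ 1`. -/
def Yset (α : ℝ) : Set ℝ :=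
  {x : ℝ | x ∈ Set.Ioo (0 : ℝ) 1 ∧ Irrational x ∧
    ∀ n : ℕ, 1 ≤ n → (∑ i ∈ Finset.range n, (cfPQ x i : ℝ)) < n * α}

/-- `X_α` : irrationals `x ∈ (0,1)` with `limsup_n (a₁(x) + ⋯ + a_n(x))/n < α`. -/
def Xset (α : ℝ) : Set ℝ :=
  {x : ℝ | x ∈ Set.Ioo (0 : ℝ) 1 ∧ Irrational x ∧
    Filter.limsup
        (fun n : ℕ => ENNReal.ofReal ((∑ i ∈ Finset.range n, (cfPQ x i : ℝ)) / n))
        Filter.atTop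
      < ENNReal.ofReal α}


open Set Filter

def Good (x : ℝ) : Prop := x ∈ Ioo (0:ℝ) 1 ∧ Irrational x

lemma Good.gauss {x : ℝ} (h : Good x) : Good (gaussMap x) := by
  obtain ⟨⟨h0, h1⟩, hi⟩ := h
  have hir : Irrational (gaussMap x) := by
    unfold gaussMap
    rw [Int.fract]
    exact (irrational_inv_iff.mpr hi).sub_intCast _
  refine ⟨⟨lt_of_le_of_ne (Int.fract_nonneg _) ?_, Int.fract_lt_one _⟩, hir⟩
  intro h
  exact hir.ne_zero h.symm

lemma Good.iter {x : ℝ} (h : Good x) (n : ℕ) : Good (gaussMap^[n] x) := by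
  induction n with
  | zero => exact h
  | succ n ih => rw [Function.iterate_succ_apply']; exact ih.gauss

lemma Good.inv0 {x : ℝ} (h : Good x) : x⁻¹ = (⌊x⁻¹⌋₊ : ℝ) + gaussMap x := by
  have : (0:ℝ) ≤ x⁻¹ := inv_nonneg.mpr h.1.1.le
  rw [natCast_floor_eq_intCast_floor this]
  exact (Int.floor_add_fract _).symm

lemma Good.inv {x : ℝ} (h : Good x) (n : ℕ) :
    (gaussMap^[n] x)⁻¹ = (cfPQ x n : ℝ) + gaussMap^[n+1] x := by
  rw [Function.iterate_succ_apply']; exact (h.iter n).inv0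

lemma Good.one_le {x : ℝ} (h : Good x) (n : ℕ) : 1 ≤ cfPQ x n := by
  unfold cfPQ
  have := h.iter n
  rw [Nat.one_le_floor_iff]
  exact (one_le_inv₀ this.1.1).mpr this.1.2.le

lemma cfPQ_succ (x : ℝ) (n : ℕ) : cfPQ x (n+1) = cfPQ (gaussMap x) n := rfl

lemma cfPQ_add (x : ℝ) (k n : ℕ) : cfPQ (gaussMap^[k] x) n = cfPQ x (k+n) := by
  unfold cfPQ
  rw [← Function.iterate_add_apply, add_comm]

/-- pairs `(q_{n-1}, q_n)` -/
noncomputable def qq (a : ℕ → ℕ) : ℕ → ℝ × ℝ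
  | 0 => (0, 1)
  | n+1 => ((qq a n).2, a n * (qq a n).2 + (qq a n).1)

lemma qq_congr {a b : ℕ → ℕ} {n : ℕ} (h : ∀ i < n, a i = b i) : qq a n = qq b n := by
  induction n with
  | zero => rfl
  | succ n ih =>
    simp only [qq]
    rw [ih (fun i hi => h i (by omega)), h n (by omega)]

lemma qq_pos {a : ℕ → ℕ} (ha : ∀ i, 1 ≤ a i) (n : ℕ) :
    0 ≤ (qq a n).1 ∧ (qq a n).1 ≤ (qq a n).2 ∧ 1 ≤ (qq a n).2 := by
  induction n with
  | zero => simp [qq]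
  | succ n ih =>
    simp only [qq]
    have : (1:ℝ) ≤ a n := by exact_mod_cast ha n
    obtain ⟨h1, h2, h3⟩ := ih
    refine ⟨by linarith, by nlinarith, by nlinarith⟩

lemma qq_growth {a : ℕ → ℕ} (ha : ∀ i, 1 ≤ a i) (n : ℕ) :
    (2:ℝ)^n ≤ (qq a n).2 * ((qq a n).2 + (qq a n).1) := by
  induction n with
  | zero => simp [qq]
  | succ n ih =>
    obtain ⟨h1, h2, h3⟩ := qq_pos ha n
    simp only [qq]
    have h : (1:ℝ) ≤ a n := by exact_mod_cast ha n
    set q := (qq a n).2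
    set p := (qq a n).1
    have : q + p ≤ a n * q + p := by nlinarith
    calc (2:ℝ)^(n+1) = 2 * 2^n := by ring
      _ ≤ 2 * (q * (q+p)) := by linarith
      _ ≤ (q + p) * ((q + p) + q) := by nlinarith
      _ ≤ _ := by gcongr

lemma dist_formula {x y : ℝ} (hx : Good x) (hy : Good y) (n : ℕ)
    (h : ∀ i < n, cfPQ x i = cfPQ y i) :
    |x - y| * (((qq (cfPQ x) n).2 + (qq (cfPQ x) n).1 * gaussMap^[n] x) *
      ((qq (cfPQ x) n).2 + (qq (cfPQ x) n).1 * gaussMap^[n] y)) =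
      |gaussMap^[n] x - gaussMap^[n] y| := by
  induction n with
  | zero => simp [qq]
  | succ n ih =>
    have ih := ih (fun i hi => h i (by omega))
    have e1 := hx.inv n
    have e2 := hy.inv n
    rw [← h n (by omega)] at e2
    have p1 := (hx.iter n).1.1
    have p2 := (hy.iter n).1.1
    simp only [qq]
    set u := gaussMap^[n] x
    set v := gaussMap^[n] y
    set q := (qq (cfPQ x) n).2
    set p := (qq (cfPQ x) n).1
    have f1 : gaussMap^[n+1] x = u⁻¹ - cfPQ x n := by linarith
    have f2 : gaussMap^[n+1] y = v⁻¹ - cfPQ x n := by linarith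
    rw [f1, f2]
    have g1 : (cfPQ x n * q + p + q * (u⁻¹ - cfPQ x n)) = (q + p * u) / u := by
      field_simp; ring
    have g2 : (cfPQ x n * q + p + q * (v⁻¹ - cfPQ x n)) = (q + p * v) / v := by
      field_simp; ring
    rw [g1, g2]
    have g3 : u⁻¹ - cfPQ x n - (v⁻¹ - cfPQ x n) = -((u - v) / (u * v)) := by
      field_simp; ring
    rw [g3, abs_neg, abs_div, abs_of_pos (mul_pos p1 p2), ← ih]
    field_simp

lemma dist_upper {x y : ℝ} (hx : Good x) (hy : Good y) (n : ℕ)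
    (h : ∀ i < n, cfPQ x i = cfPQ y i) :
    |x - y| * (qq (cfPQ x) n).2 ^ 2 ≤ 1 := by
  have f := dist_formula hx hy n h
  obtain ⟨h1, h2, h3⟩ := qq_pos hx.one_le n
  have p1 := (hx.iter n).1
  have p2 := (hy.iter n).1
  set u := gaussMap^[n] x
  set v := gaussMap^[n] y
  set q := (qq (cfPQ x) n).2
  set p := (qq (cfPQ x) n).1
  have : |u - v| ≤ 1 := by
    rw [abs_le]; constructor <;> linarith [p1.1, p1.2, p2.1, p2.2]
  refine le_trans ?_ this
  rw [← f]
  gcongr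
  rw [pow_two]
  have := mul_nonneg h1 p1.1.le
  have := mul_nonneg h1 p2.1.le
  gcongr <;> linarith

lemma gap {u v B : ℝ} (hu : Good u) (hv : Good v) (hne : cfPQ u 0 ≠ cfPQ v 0)
    (bu : ∀ i < 3, (cfPQ u i : ℝ) ≤ B) (bv : ∀ i < 3, (cfPQ v i : ℝ) ≤ B) :
    1 ≤ (B + 2)^3 * |u - v| := by
  have hB : 1 ≤ B := le_trans (by exact_mod_cast hu.one_le 0) (bu 0 (by omega))
  -- bounds on the first image
  have key : ∀ w, Good w → (∀ i < 3, (cfPQ w i : ℝ) ≤ B) →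
      w⁻¹ ≤ B + 1 ∧ (B+2)⁻¹ ≤ gaussMap w ∧ gaussMap w ≤ 1 := by
    intro w hw bw
    have e0 := hw.inv 0
    have e1 := hw.inv 1
    simp only [Function.iterate_zero, id, zero_add, Function.iterate_one] at e0 e1
    have i1 := (hw.iter 1).1
    have i2 := (hw.iter 2).1
    simp only [Function.iterate_one] at i1
    have := bw 0 (by omega)
    have := bw 1 (by omega)
    refine ⟨by linarith [i1.2], ?_, i1.2.le⟩
    rw [inv_le_comm₀ (by linarith) i1.1, e1]
    have : gaussMap^[1+1] w < 1 := i2.2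
    linarith
  have key2 : ∀ w, Good w → (∀ i < 3, (cfPQ w i : ℝ) ≤ B) → gaussMap w ≤ 1 - (B+2)⁻¹ := by
    intro w hw bw
    have e1 := hw.gauss.inv0
    have i1 := hw.gauss.1
    have i2 := hw.gauss.gauss.1
    have e2 := hw.gauss.gauss.inv0
    have i3 := hw.gauss.gauss.gauss.1
    have b2 : ((⌊(gaussMap (gaussMap w))⁻¹⌋₊:ℕ) : ℝ) ≤ B := bw 2 (by omega)
    have o1 : (1:ℝ) ≤ (⌊(gaussMap w)⁻¹⌋₊:ℕ) := by exact_mod_cast hw.one_le 1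
    have l2 : (B+1)⁻¹ ≤ gaussMap (gaussMap w) := by
      rw [inv_le_comm₀ (by linarith) i2.1]; linarith [i3.2]
    have : gaussMap w ≤ (1 + (B+1)⁻¹)⁻¹ := by
      have hp : 0 < (B+1)⁻¹ := by apply inv_pos.mpr; linarith
      rw [le_inv_comm₀ i1.1 (by linarith), e1]
      linarith
    refine this.trans (le_of_eq ?_)
    have : B + 1 ≠ 0 := by linarith
    have : B + 2 ≠ 0 := by linarith
    have : 1 + (B+1)⁻¹ = (B+2)/(B+1) := by field_simp; ring
    rw [this, inv_div]; field_simp; ring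
  obtain ⟨a1, a2, a3⟩ := key u hu bu
  obtain ⟨c1, c2, c3⟩ := key v hv bv
  have a4 := key2 u hu bu
  have c4 := key2 v hv bv
  have e1 := hu.inv0
  have e2 := hv.inv0
  have hne' : ⌊u⁻¹⌋₊ ≠ ⌊v⁻¹⌋₊ := hne
  have hd : (B+2)⁻¹ ≤ |u⁻¹ - v⁻¹| := by
    rcases lt_or_gt_of_ne hne' with hlt | hlt
    · have : (⌊u⁻¹⌋₊:ℝ) + 1 ≤ (⌊v⁻¹⌋₊:ℝ) := by exact_mod_cast hlt
      have hp : 0 < (B+2)⁻¹ := by apply inv_pos.mpr; linarith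
      rw [abs_sub_comm]
      refine le_trans ?_ (le_abs_self _)
      linarith
    · have : (⌊v⁻¹⌋₊:ℝ) + 1 ≤ (⌊u⁻¹⌋₊:ℝ) := by exact_mod_cast hlt
      have hp : 0 < (B+2)⁻¹ := by apply inv_pos.mpr; linarith
      refine le_trans ?_ (le_abs_self _)
      linarith
  have hu0 := hu.1.1
  have hv0 := hv.1.1
  have e3 : |u⁻¹ - v⁻¹| = |u - v| * (u⁻¹ * v⁻¹) := by
    have : u⁻¹ - v⁻¹ = -((u - v) * (u⁻¹ * v⁻¹)) := by field_simp; ring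
    rw [this, abs_neg, abs_mul, abs_of_pos (a := u⁻¹ * v⁻¹) (by positivity)]
  have e4 : (B+2)⁻¹ ≤ |u - v| * ((B+2) * (B+2)) := by
    rw [e3] at hd
    refine hd.trans ?_
    gcongr <;> linarith
  have : 0 < B + 2 := by linarith
  calc (1:ℝ) = (B+2) * (B+2)⁻¹ := by field_simp
    _ ≤ (B+2) * (|u - v| * ((B+2) * (B+2))) := by gcongr
    _ = _ := by ring

lemma dist_lower {x y B : ℝ} (hx : Good x) (hy : Good y) (n : ℕ)
    (h : ∀ i < n, cfPQ x i = cfPQ y i) (hne : cfPQ x n ≠ cfPQ y n)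
    (bx : ∀ i < 3, (cfPQ x (n+i) : ℝ) ≤ B) (bby : ∀ i < 3, (cfPQ y (n+i) : ℝ) ≤ B) :
    1 ≤ 4 * (qq (cfPQ x) n).2 ^ 2 * (B + 2)^3 * |x - y| := by
  have f := dist_formula hx hy n h
  have g := gap (B := B) (hx.iter n) (hy.iter n) (by simpa only [cfPQ_add, add_zero] using hne)
    (by simpa only [cfPQ_add] using bx) (by simpa only [cfPQ_add] using bby)
  have hB : 1 ≤ B := le_trans (by exact_mod_cast hx.one_le _) (bx 0 (by omega))
  obtain ⟨h1, h2, h3⟩ := qq_pos hx.one_le n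
  have p1 := (hx.iter n).1
  have p2 := (hy.iter n).1
  rw [← f] at g
  set u := gaussMap^[n] x
  set v := gaussMap^[n] y
  set q := (qq (cfPQ x) n).2
  set p := (qq (cfPQ x) n).1
  refine g.trans ?_
  have k1 : q + p * u ≤ 2 * q := by nlinarith [p1.1, p1.2]
  have k2 : q + p * v ≤ 2 * q := by nlinarith [p2.1, p2.2]
  have k0 : 0 ≤ q + p * v := by have := mul_nonneg h1 p2.1.le; linarith
  calc (B+2)^3 * (|x - y| * ((q + p * u) * (q + p * v))) ≤ (B+2)^3 * (|x - y| * ((2*q) * (2*q))) := by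
        have : 0 ≤ (B+2)^3 := by apply pow_nonneg; linarith
        gcongr
    _ = _ := by ring

/-! existence -/

def cyl : ℕ → (ℕ → ℕ) → Set ℝ
  | 0, _ => Icc 0 1
  | n+1, a => (fun y : ℝ => ((a 0 : ℝ) + y)⁻¹) '' cyl n (fun i => a (i+1))

lemma cyl_sub (n : ℕ) : ∀ (a : ℕ → ℕ), (∀ i, 1 ≤ a i) → cyl n a ⊆ Icc 0 1 := by
  induction n with
  | zero => intro a _; exact subset_rfl
  | succ n ih =>
    rintro a ha _ ⟨y, hy, rfl⟩
    have := ih _ (fun i => ha (i+1)) hy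
    have h : (1:ℝ) ≤ a 0 := by exact_mod_cast ha 0
    have h0 := this.1
    exact ⟨inv_nonneg.mpr (by positivity), inv_le_one_of_one_le₀ (by linarith)⟩

lemma cyl_anti (n : ℕ) : ∀ (a : ℕ → ℕ), (∀ i, 1 ≤ a i) → cyl (n+1) a ⊆ cyl n a := by
  induction n with
  | zero => intro a ha; exact cyl_sub 1 a ha
  | succ n ih =>
    intro a ha
    exact image_mono (ih _ (fun i => ha (i+1)))

lemma cyl_compact (n : ℕ) : ∀ (a : ℕ → ℕ), (∀ i, 1 ≤ a i) → IsCompact (cyl n a) := by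
  induction n with
  | zero => intro a _; exact isCompact_Icc
  | succ n ih =>
    intro a ha
    refine (ih _ (fun i => ha (i+1))).image_of_continuousOn ?_
    refine ContinuousOn.inv₀ (by fun_prop) ?_
    intro y hy
    have := (cyl_sub n _ (fun i => ha (i+1)) hy).1
    have h : (1:ℝ) ≤ a 0 := by exact_mod_cast ha 0
    linarith

lemma cyl_nonempty (n : ℕ) : ∀ (a : ℕ → ℕ), (cyl n a).Nonempty := by
  induction n with
  | zero => intro a; exact ⟨0, by simp [cyl]⟩
  | succ n ih => intro a; exact (ih _).image _

def Kset (a : ℕ → ℕ) : Set ℝ := ⋂ n, cyl n a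

lemma Kset_nonempty {a : ℕ → ℕ} (ha : ∀ i, 1 ≤ a i) : (Kset a).Nonempty :=
  IsCompact.nonempty_iInter_of_sequence_nonempty_isCompact_isClosed _
    (fun n => cyl_anti n a ha) (fun n => cyl_nonempty n a) (cyl_compact 0 a ha)
    (fun n => (cyl_compact n a ha).isClosed)

lemma Kset_step {a : ℕ → ℕ} (_ha : ∀ i, 1 ≤ a i) {x : ℝ} (hx : x ∈ Kset a) :
    ∃ y ∈ Kset (fun i => a (i+1)), x = ((a 0 : ℝ) + y)⁻¹ := by
  refine ⟨x⁻¹ - a 0, ?_, by simp⟩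
  refine mem_iInter.mpr fun n => ?_
  obtain ⟨y, hy, e⟩ := mem_iInter.mp hx (n+1)
  have : x⁻¹ - a 0 = y := by rw [← e]; simp
  rwa [this]

lemma Kset_pos {a : ℕ → ℕ} (ha : ∀ i, 1 ≤ a i) {x : ℝ} (hx : x ∈ Kset a) : 0 < x := by
  obtain ⟨y, hy, rfl⟩ := Kset_step ha hx
  have h : (1:ℝ) ≤ a 0 := by exact_mod_cast ha 0
  have : 0 ≤ y := (cyl_sub 0 _ (fun i => ha (i+1)) (mem_iInter.mp hy 0)).1
  positivity

lemma Kset_mem {a : ℕ → ℕ} (ha : ∀ i, 1 ≤ a i) {x : ℝ} (hx : x ∈ Kset a) : x ∈ Ioo (0:ℝ) 1 := by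
  refine ⟨Kset_pos ha hx, ?_⟩
  obtain ⟨y, hy, rfl⟩ := Kset_step ha hx
  have h : (1:ℝ) ≤ a 0 := by exact_mod_cast ha 0
  have := Kset_pos (fun i => ha (i+1)) hy
  exact inv_lt_one_of_one_lt₀ (by linarith)

lemma Kset_gauss {a : ℕ → ℕ} (ha : ∀ i, 1 ≤ a i) {x : ℝ} (hx : x ∈ Kset a) :
    gaussMap x ∈ Kset (fun i => a (i+1)) ∧ ⌊x⁻¹⌋₊ = a 0 := by
  obtain ⟨y, hy, rfl⟩ := Kset_step ha hx
  have hy1 := Kset_mem (fun i => ha (i+1)) hy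
  have : gaussMap ((a 0 : ℝ) + y)⁻¹ = y := by
    unfold gaussMap
    rw [inv_inv, Int.fract_natCast_add, Int.fract_eq_self.mpr ⟨hy1.1.le, hy1.2⟩]
  rw [this, inv_inv]
  refine ⟨hy, ?_⟩
  rw [Nat.floor_eq_iff (by have := hy1.1; positivity)]
  constructor <;> linarith [hy1.1, hy1.2]

lemma Kset_iter {a : ℕ → ℕ} (ha : ∀ i, 1 ≤ a i) {x : ℝ} (hx : x ∈ Kset a) (n : ℕ) :
    gaussMap^[n] x ∈ Kset (fun i => a (i+n)) := by
  induction n with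
  | zero => exact hx
  | succ n ih =>
    rw [Function.iterate_succ_apply']
    have := (Kset_gauss (fun i => ha (i+n)) ih).1
    have e : (fun i => a (i+(n+1))) = fun i => a (i+1+n) := by
      funext i; congr 1; omega
    rw [e]; exact this

lemma rational_terminates (d : ℕ) : ∀ (x : ℝ) (m : ℤ), 0 < d → x * d = m →
    ∃ n, gaussMap^[n] x ∉ Ioo (0:ℝ) 1 := by
  induction d using Nat.strong_induction_on with
  | _ d ih =>
    intro x m hd hm
    by_cases hx : x ∈ Ioo (0:ℝ) 1
    · have hd' : (0:ℝ) < d := by exact_mod_cast hd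
      have hx0 := hx.1
      have m0 : (0:ℝ) < m := by rw [← hm]; positivity
      have m1 : (m:ℝ) < d := by rw [← hm]; nlinarith [hx.2]
      have m0' : 0 < m := by exact_mod_cast m0
      lift m to ℕ using m0'.le
      have m1' : m < d := by exact_mod_cast m1
      simp only [Int.cast_natCast] at m0 hm
      obtain ⟨n, hn⟩ := ih m m1' (gaussMap x) ((d:ℤ) - ⌊x⁻¹⌋ * m) (by exact_mod_cast m0) (by
        unfold gaussMap Int.fract
        push_cast
        have : x⁻¹ * m = d := by rw [← hm]; field_simp
        rw [sub_mul, this])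
      exact ⟨n+1, hn⟩
    · exact ⟨0, hx⟩

lemma exists_cf {a : ℕ → ℕ} (ha : ∀ i, 1 ≤ a i) : ∃ x, Good x ∧ ∀ i, cfPQ x i = a i := by
  obtain ⟨x, hx⟩ := Kset_nonempty ha
  refine ⟨x, ⟨Kset_mem ha hx, ?_⟩, ?_⟩
  · rintro ⟨r, hr⟩
    obtain ⟨n, hn⟩ := rational_terminates r.den x r.num r.den_pos (by
      rw [← hr]; exact_mod_cast Rat.mul_den_eq_num r)
    exact hn (Kset_mem (fun i => ha (i+n)) (Kset_iter ha hx n))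
  · intro i
    have := (Kset_gauss (fun j => ha (j+i)) (Kset_iter ha hx i)).2
    simpa [cfPQ] using this

/-! dimension via an anti-Hölder map -/
lemma dimH_anti {S T : Set ℝ} (k : ℝ → ℝ) (hk : ∀ x ∈ S, k x ∈ T) (C r : ℝ) (hC : 0 ≤ C)
    (hr : 0 < r) (h : ∀ x ∈ S, ∀ y ∈ S, |x - y| ≤ C * |k x - k y| ^ r) :
    ENNReal.ofReal r * dimH S ≤ dimH T := by
  lift C to NNReal using hC
  lift r to NNReal using hr.le
  have hr' : 0 < r := by exact_mod_cast hr
  have hinj : InjOn k S := by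
    intro x hx y hy e
    have := h x hx y hy
    rw [e, sub_self, abs_zero, Real.zero_rpow hr.ne', mul_zero] at this
    linarith [abs_nonpos_iff.mp this]
  have hold : HolderOnWith C r (Function.invFunOn k S) (k '' S) := by
    rintro _ ⟨x, hx, rfl⟩ _ ⟨y, hy, rfl⟩
    rw [hinj.leftInvOn_invFunOn hx, hinj.leftInvOn_invFunOn hy]
    have := h x hx y hy
    rw [edist_dist, edist_dist, Real.dist_eq, Real.dist_eq, ENNReal.ofReal_rpow_of_nonneg (abs_nonneg _) hr.le,
      ← ENNReal.ofReal_coe_nnreal, ← ENNReal.ofReal_mul (NNReal.coe_nonneg C)]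
    exact ENNReal.ofReal_le_ofReal this
  have e := hold.dimH_image_le hr'
  rw [hinj.leftInvOn_invFunOn.image_image] at e
  have e2 : dimH (k '' S) ≤ dimH T := dimH_mono (by rintro _ ⟨x, hx, rfl⟩; exact hk x hx)
  rw [ENNReal.ofReal_coe_nnreal, mul_comm]
  refine le_trans ?_ e2
  rwa [ENNReal.le_div_iff_mul_le (Or.inl (by exact_mod_cast hr'.ne')) (Or.inl ENNReal.coe_ne_top)] at e

/-! X ≤ Y -/

lemma X_shift {α : ℝ} {x : ℝ} (hx : x ∈ Xset α) : ∃ k, gaussMap^[k] x ∈ Yset α := by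
  obtain ⟨h0, h1, h2⟩ := hx
  have hg : Good x := ⟨h0, h1⟩
  have ev := eventually_lt_of_limsup_lt h2
  set S : ℕ → ℝ := fun n => ∑ i ∈ Finset.range n, (cfPQ x i : ℝ) with hS
  have main : ∃ k, ∀ n > k, S n - S k < ((n:ℝ) - k) * α := by
    by_contra hcon
    push Not at hcon
    have fr : ∀ m, ∃ n ≥ m, 0 ≤ S n - n * α := by
      intro m
      induction m with
      | zero => exact ⟨0, le_rfl, by simp [hS]⟩
      | succ m ih =>
        obtain ⟨n, hn, hn'⟩ := ih
        obtain ⟨n2, h3, h4⟩ := hcon n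
        exact ⟨n2, by omega, by linarith⟩
    obtain ⟨N, hN⟩ := eventually_atTop.mp ev
    obtain ⟨n, hn, hn'⟩ := fr (N+1)
    have := hN n (by omega)
    have h5 := (ENNReal.ofReal_lt_ofReal_iff' .. ).mp this |>.1
    have hnp : (0:ℝ) < n := by
      have : 0 < n := by omega
      exact_mod_cast this
    rw [div_lt_iff₀ hnp] at h5
    have : S n < α * n := h5
    linarith
  obtain ⟨k, hk⟩ := main
  refine ⟨k, (hg.iter k).1, (hg.iter k).2, fun n hn => ?_⟩
  have := hk (k + n) (by omega)
  simp only [cfPQ_add]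
  have e : S (k+n) = S k + ∑ i ∈ Finset.range n, (cfPQ x (k+i) : ℝ) := Finset.sum_range_add _ k n
  rw [e] at this
  push_cast at this
  linarith

lemma dim_preimage (Y : Set ℝ) (k : ℕ) :
    dimH {x | Good x ∧ gaussMap^[k] x ∈ Y} ≤ dimH Y := by
  induction k with
  | zero => exact dimH_mono fun x hx => hx.2
  | succ k ih =>
    have sub : {x | Good x ∧ gaussMap^[k+1] x ∈ Y} ⊆
        ⋃ b : ℕ, (fun y : ℝ => ((b:ℝ) + 1 + y)⁻¹) '' {x | Good x ∧ gaussMap^[k] x ∈ Y} := by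
      rintro x ⟨hx, hx2⟩
      refine mem_iUnion.mpr ⟨cfPQ x 0 - 1, gaussMap x, ⟨hx.gauss, hx2⟩, ?_⟩
      have h1 := hx.one_le 0
      have := hx.inv0
      have h2 : ((cfPQ x 0 - 1 : ℕ) : ℝ) + 1 = cfPQ x 0 := by
        exact_mod_cast Nat.sub_add_cancel h1
      simp only [h2]
      rw [inv_eq_iff_eq_inv, this]; rfl
    refine (dimH_mono sub).trans ?_
    rw [dimH_iUnion]
    refine iSup_le fun b => le_trans ?_ ih
    refine LipschitzOnWith.dimH_image_le (K := 1) ?_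
    refine LipschitzOnWith.of_dist_le_mul ?_
    intro u hu v hv
    have hu0 := hu.1.1.1
    have hv0 := hv.1.1.1
    rw [Real.dist_eq, Real.dist_eq]
    have hb : (0:ℝ) ≤ b := by positivity
    have : ((b:ℝ) + 1 + u)⁻¹ - ((b:ℝ) + 1 + v)⁻¹ =
      -((u - v) * (((b:ℝ) + 1 + u)⁻¹ * ((b:ℝ) + 1 + v)⁻¹)) := by
      field_simp; ring
    rw [this, abs_neg, abs_mul, abs_of_pos (a := ((b:ℝ) + 1 + u)⁻¹ * ((b:ℝ) + 1 + v)⁻¹) (by positivity)]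
    simp only [NNReal.coe_one, one_mul]
    refine mul_le_of_le_one_right (abs_nonneg _) ?_
    refine mul_le_one₀ (inv_le_one_of_one_le₀ (by linarith)) (by positivity)
      (inv_le_one_of_one_le₀ (by linarith))

lemma dim_X_le (α : ℝ) : dimH (Xset α) ≤ dimH (Yset α) := by
  have sub : Xset α ⊆ ⋃ k : ℕ, {x | Good x ∧ gaussMap^[k] x ∈ Yset α} := by
    intro x hx
    obtain ⟨k, hk⟩ := X_shift hx
    exact mem_iUnion.mpr ⟨k, ⟨hx.1, hx.2.1⟩, hk⟩
  refine (dimH_mono sub).trans ?_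
  rw [dimH_iUnion]
  exact iSup_le fun k => dim_preimage _ k

/-! bounded digits -/

noncomputable def Lw (p : ℝ × ℝ) : ℝ := (p.2 * (p.2 + p.1))⁻¹
noncomputable def nxt (p : ℝ × ℝ) (b : ℕ) : ℝ × ℝ := (p.2, b * p.2 + p.1)

noncomputable def UU (s : ℝ) (a : ℕ → ℕ) : ℕ → ℝ
  | 0 => 0
  | n+1 => UU s a n + ∑ c ∈ Finset.range (a n - 1), Lw (nxt (qq a n) (c+1)) ^ s

lemma UU_congr {s : ℝ} {a b : ℕ → ℕ} {n : ℕ} (h : ∀ i < n, a i = b i) : UU s a n = UU s b n := by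
  induction n with
  | zero => rfl
  | succ n ih =>
    simp only [UU]
    rw [ih (fun i hi => h i (by omega)), h n (by omega), qq_congr (fun i hi => h i (by omega))]

lemma tele {p : ℝ × ℝ} (h1 : 0 ≤ p.1) (h3 : 1 ≤ p.2) (N : ℕ) :
    ∑ c ∈ Finset.range N, Lw (nxt p (c+1)) =
      (1 / (p.2 + p.1) - 1 / ((N+1) * p.2 + p.1)) / p.2 := by
  obtain ⟨p, q⟩ := p
  simp only at h1 h3
  have hq : 0 < q := by linarith
  induction N with
  | zero => simp
  | succ N ih =>
    rw [Finset.sum_range_succ, ih]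
    simp only [Lw, nxt]
    push_cast
    field_simp
    ring

lemma kraft {s : ℝ} (hs1 : s < 1) {N : ℕ}
    (hN : ((N:ℝ) + 2) ≤ 2 ^ (1 - s) * N) {p : ℝ × ℝ} (h1 : 0 ≤ p.1) (h2 : p.1 ≤ p.2)
    (h3 : 1 ≤ p.2) :
    Lw p ^ s ≤ ∑ c ∈ Finset.range N, Lw (nxt p (c+1)) ^ s := by
  have hL : 0 < Lw p := by unfold Lw; have : 0 < p.2 := by linarith
                           positivity
  have term : ∀ c : ℕ, Lw (nxt p (c+1)) * ((Lw p / 2) ^ (s-1)) ≤ Lw (nxt p (c+1)) ^ s := by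
    intro c
    have hq : 0 < p.2 := by linarith
    have pos : 0 < Lw (nxt p (c+1)) := by
      simp only [Lw, nxt]; push_cast; positivity
    have le : Lw (nxt p (c+1)) ≤ Lw p / 2 := by
      simp only [Lw, nxt]; push_cast
      rw [div_eq_mul_inv, ← mul_inv]
      apply inv_anti₀ (by positivity)
      have hc : (0:ℝ) ≤ c := by positivity
      have hcq : 0 ≤ c * p.2 := by positivity
      have a1 : p.2 + p.1 ≤ (c+1) * p.2 + p.1 := by linarith
      have a2 : 2 * p.2 ≤ (c+1) * p.2 + p.1 + p.2 := by linarith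
      have := mul_le_mul a1 a2 (by positivity) (by positivity)
      linarith
    have : (Lw p / 2) ^ (s-1) ≤ Lw (nxt p (c+1)) ^ (s-1) :=
      Real.rpow_le_rpow_of_nonpos pos le (by linarith)
    calc _ ≤ Lw (nxt p (c+1)) * Lw (nxt p (c+1)) ^ (s-1) := by gcongr
      _ = _ := by
        rw [Real.rpow_sub_one pos.ne']; field_simp
  refine le_trans ?_ (Finset.sum_le_sum fun c _ => term c)
  rw [← Finset.sum_mul, tele h1 h3]
  have e : (Lw p / 2) ^ (s-1) = Lw p ^ s / Lw p * 2 ^ (1-s) := by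
    rw [Real.div_rpow hL.le (by norm_num), Real.rpow_sub_one hL.ne']
    rw [show (1 - s) = -(s-1) by ring, Real.rpow_neg (by norm_num)]
    field_simp
  rw [e]
  have hls : 0 < Lw p ^ s := Real.rpow_pos_of_pos hL s
  set t : ℝ := 2 ^ (1-s)
  have hq : 0 < p.2 := by linarith
  have k : 1 ≤ (1 / (p.2 + p.1) - 1 / ((N+1) * p.2 + p.1)) / p.2 / Lw p * t := by
    have : (1 / (p.2 + p.1) - 1 / ((N+1) * p.2 + p.1)) / p.2 / Lw p = N * p.2 / ((N+1) * p.2 + p.1) := by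
      unfold Lw; field_simp; ring
    rw [this, div_mul_eq_mul_div, le_div_iff₀ (by positivity)]
    nlinarith
  calc Lw p ^ s = Lw p ^ s * 1 := by ring
    _ ≤ Lw p ^ s * ((1 / (p.2 + p.1) - 1 / ((N+1) * p.2 + p.1)) / p.2 / Lw p * t) := by gcongr
    _ = _ := by ring

lemma pick (f : ℕ → ℝ) (N : ℕ) (v : ℝ) (h0 : 0 ≤ v) (h1 : v < ∑ c ∈ Finset.range N, f c) :
    ∃ b, 1 ≤ b ∧ b ≤ N ∧ ∑ c ∈ Finset.range (b - 1), f c ≤ v ∧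
      v < ∑ c ∈ Finset.range (b - 1), f c + f (b-1) := by
  induction N with
  | zero => simp at h1; linarith
  | succ N ih =>
    by_cases h : v < ∑ c ∈ Finset.range N, f c
    · obtain ⟨b, x1, x2, x3⟩ := ih h
      exact ⟨b, x1, by omega, x3⟩
    · refine ⟨N+1, by omega, le_rfl, by simpa using h, ?_⟩
      rw [Finset.sum_range_succ] at h1
      simpa using h1

lemma exists_code {s : ℝ} (hs1 : s < 1) {N : ℕ}
    (hN : ((N:ℝ) + 2) ≤ 2 ^ (1 - s) * N) {t : ℝ} (ht : t ∈ Ico (0:ℝ) 1) :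
    ∃ a : ℕ → ℕ, (∀ i, 1 ≤ a i ∧ a i ≤ N) ∧
      ∀ n, UU s a n ≤ t ∧ t < UU s a n + Lw (qq a n) ^ s := by
  let Inv : ℝ × (ℝ × ℝ) → Prop := fun w =>
    (0 ≤ w.2.1 ∧ w.2.1 ≤ w.2.2 ∧ 1 ≤ w.2.2) ∧ w.1 ≤ t ∧ t < w.1 + Lw w.2 ^ s
  let step : ℝ × (ℝ × ℝ) → ℕ → ℝ × (ℝ × ℝ) := fun w b =>
    (w.1 + ∑ c ∈ Finset.range (b - 1), Lw (nxt w.2 (c+1)) ^ s, nxt w.2 b)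
  have ex : ∀ w, ∃ b, Inv w → (1 ≤ b ∧ b ≤ N ∧ Inv (step w b)) := by
    intro w
    by_cases hw : Inv w
    · obtain ⟨⟨i1, i2, i3⟩, i4, i5⟩ := hw
      have kr := kraft hs1 hN i1 i2 i3
      obtain ⟨b, b1, b2, b3, b4⟩ := pick (fun c => Lw (nxt w.2 (c+1)) ^ s) N (t - w.1)
        (by linarith) (by linarith)
      refine ⟨b, fun _ => ⟨b1, b2, ⟨?_, ?_, ?_⟩, ?_, ?_⟩⟩
      · simp only [step, nxt]; linarith
      · simp only [step, nxt]
        have : (1:ℝ) ≤ b := by exact_mod_cast b1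
        nlinarith
      · simp only [step, nxt]
        have : (1:ℝ) ≤ b := by exact_mod_cast b1
        nlinarith
      · simp only [step]; linarith
      · simp only [step]
        rw [Nat.sub_add_cancel b1] at b4
        linarith
    · exact ⟨0, fun h => absurd h hw⟩
  choose dig hdig using ex
  let st : ℕ → ℝ × (ℝ × ℝ) := fun n => Nat.rec (0, (0, 1)) (fun _ w => step w (dig w)) n
  have st_succ : ∀ n, st (n+1) = step (st n) (dig (st n)) := fun n => rfl
  have inv : ∀ n, Inv (st n) := by
    intro n
    induction n with
    | zero => refine ⟨by simp [st], by simpa [st] using ht.1, ?_⟩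
              simpa [st, Lw] using ht.2
    | succ n ih => rw [st_succ]; exact (hdig _ ih).2.2
  let a : ℕ → ℕ := fun n => dig (st n)
  have hst : ∀ n, st n = (UU s a n, qq a n) := by
    intro n
    induction n with
    | zero => rfl
    | succ n ih =>
      rw [st_succ]
      have : dig (st n) = a n := rfl
      rw [this, ih]
      rfl
  refine ⟨a, fun i => ⟨(hdig _ (inv i)).1, (hdig _ (inv i)).2.1⟩, fun n => ?_⟩
  have := (inv n).2
  rw [hst] at this
  exact this

lemma bounded_mem_X {N : ℕ} {α : ℝ} (h : (N:ℝ) < α) {x : ℝ} (hx : Good x)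
    (hb : ∀ i, cfPQ x i ≤ N) : x ∈ Xset α := by
  refine ⟨hx.1, hx.2, ?_⟩
  have hα : 0 < α := lt_of_le_of_lt (by positivity) h
  refine lt_of_le_of_lt ?_ ((ENNReal.ofReal_lt_ofReal_iff hα).mpr h)
  refine limsup_le_of_le (by isBoundedDefault) (Eventually.of_forall fun n => ?_)
  apply ENNReal.ofReal_le_ofReal
  refine div_le_of_le_mul₀ (by positivity) (by positivity) ?_
  have : ∑ i ∈ Finset.range n, (cfPQ x i : ℝ) ≤ ∑ i ∈ Finset.range n, (N:ℝ) :=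
    Finset.sum_le_sum fun i _ => by exact_mod_cast hb i
  simpa [mul_comm] using this

lemma first_diff {a b : ℕ → ℕ} (h : a ≠ b) : ∃ n, (∀ i < n, a i = b i) ∧ a n ≠ b n := by
  classical
  have : ∃ n, a n ≠ b n := Function.ne_iff.mp h
  exact ⟨Nat.find this, fun i hi => not_not.mp (Nat.find_min this hi), Nat.find_spec this⟩

lemma dim_X_lower {s : ℝ} (hs0 : 0 < s) (hs1 : s < 1) :
    ∃ A : ℝ, ∀ α > A, ENNReal.ofReal s ≤ dimH (Xset α) := by
  have hgt : (1:ℝ) < 2 ^ (1-s) := Real.one_lt_rpow (by norm_num) (by linarith)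
  obtain ⟨N, hN⟩ := exists_nat_ge (2 / ((2:ℝ) ^ (1-s) - 1))
  have hN' : ((N:ℝ) + 2) ≤ 2 ^ (1 - s) * N := by
    rw [div_le_iff₀ (by linarith)] at hN
    linarith
  refine ⟨N, fun α hα => ?_⟩
  have ex : ∀ t : ℝ, ∃ x, t ∈ Ico (0:ℝ) 1 → Good x ∧ (∀ i, cfPQ x i ≤ N) ∧
      ∀ n, UU s (cfPQ x) n ≤ t ∧ t < UU s (cfPQ x) n + Lw (qq (cfPQ x) n) ^ s := by
    intro t
    by_cases ht : t ∈ Ico (0:ℝ) 1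
    · obtain ⟨a, ha, hc⟩ := exists_code hs1 hN' ht
      obtain ⟨x, hx, hxa⟩ := exists_cf (fun i => (ha i).1)
      have : cfPQ x = a := funext hxa
      exact ⟨x, fun _ => ⟨hx, by rw [this]; exact fun i => (ha i).2, by rw [this]; exact hc⟩⟩
    · exact ⟨0, fun h => absurd h ht⟩
  choose k hk using ex
  have d1 : dimH (Ico (0:ℝ) 1) = 1 := (Real.dimH_of_nonempty_interior
    (by rw [interior_Ico (a := (0:ℝ)) (b := 1)]; exact ⟨1/2, by norm_num⟩)).trans (by simp)
  have key := dimH_anti (S := Ico (0:ℝ) 1) (T := Xset α) k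
    (fun x hx => bounded_mem_X hα (hk x hx).1 (hk x hx).2.1)
    ((4 * ((N:ℝ)+2)^3)^s) s (by positivity) hs0 ?_
  · rwa [d1, mul_one] at key
  intro t ht t' ht'
  obtain ⟨g1, b1, c1⟩ := hk t ht
  obtain ⟨g2, b2, c2⟩ := hk t' ht'
  have close : ∀ n, (∀ i < n, cfPQ (k t) i = cfPQ (k t') i) →
      |t - t'| ≤ Lw (qq (cfPQ (k t)) n) ^ s := by
    intro n hn
    obtain ⟨u1, u2⟩ := c1 n
    obtain ⟨u3, u4⟩ := c2 n
    rw [← UU_congr hn] at u3 u4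
    rw [← qq_congr hn] at u4
    rw [abs_le]; constructor <;> linarith
  by_cases hab : cfPQ (k t) = cfPQ (k t')
  · have z : |t - t'| ≤ 0 := by
      have lim : Tendsto (fun n : ℕ => (((2:ℝ)⁻¹)^s)^n) atTop (nhds 0) :=
        tendsto_pow_atTop_nhds_zero_of_lt_one (by positivity)
          (Real.rpow_lt_one (by norm_num) (by norm_num) hs0)
      refine ge_of_tendsto' lim fun n => ?_
      refine (close n (fun i _ => by rw [hab])).trans ?_
      have gr := qq_growth g1.one_le n
      have : Lw (qq (cfPQ (k t)) n) ≤ (2:ℝ)⁻¹ ^ n := by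
        rw [inv_pow]; exact inv_anti₀ (by positivity) gr
      rw [← Real.rpow_natCast, ← Real.rpow_mul (by norm_num), mul_comm s, Real.rpow_mul (by norm_num),
        Real.rpow_natCast]
      refine Real.rpow_le_rpow ?_ this hs0.le
      refine inv_nonneg.mpr (le_trans (by positivity) gr)
    exact z.trans (by positivity)
  · obtain ⟨n, hn, hne⟩ := first_diff hab
    have lo := dist_lower (B := N) g1 g2 n hn hne (fun i _ => by exact_mod_cast b1 _)
      (fun i _ => by exact_mod_cast b2 _)
    refine (close n hn).trans ?_
    rw [← Real.mul_rpow (by positivity) (abs_nonneg _)]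
    obtain ⟨h1, h2, h3⟩ := qq_pos g1.one_le n
    refine Real.rpow_le_rpow ?_ ?_ hs0.le
    · exact inv_nonneg.mpr (by positivity)
    · unfold Lw
      rw [inv_le_iff_one_le_mul₀ (by positivity)]
      refine lo.trans ?_
      set q := (qq (cfPQ (k t)) n).2
      set p := (qq (cfPQ (k t)) n).1
      have : q^2 ≤ q * (q + p) := by nlinarith
      calc 4 * q^2 * ((N:ℝ)+2)^3 * |k t - k t'| ≤ 4 * (q * (q+p)) * ((N:ℝ)+2)^3 * |k t - k t'| := by gcongr
        _ = _ := by ring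

lemma X_tendsto : Tendsto (fun α : ℝ => dimH (Xset α)) atTop (nhds 1) := by
  have up : ∀ α, dimH (Xset α) ≤ 1 := fun α =>
    (dimH_mono (subset_univ _)).trans (le_of_eq Real.dimH_univ)
  rw [tendsto_order]
  refine ⟨fun c hc => ?_, fun c hc => Eventually.of_forall fun α => (up α).trans_lt hc⟩
  obtain ⟨d, hd1, hd2⟩ := exists_between hc
  have dt : d ≠ ⊤ := (hd2.trans ENNReal.one_lt_top).ne
  obtain ⟨A, hA⟩ := dim_X_lower (s := d.toReal)
    (ENNReal.toReal_pos (by exact (bot_le.trans_lt hd1).ne') dt)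
    (by simpa using (ENNReal.toReal_lt_toReal dt ENNReal.one_ne_top).mpr hd2)
  filter_upwards [eventually_gt_atTop A] with α hα
  have := hA α hα
  rw [ENNReal.ofReal_toReal dt] at this
  exact hd1.trans_le this

/-! Y ≤ X : inserting ones -/

def ins (M : ℕ) (a : ℕ → ℕ) (j : ℕ) : ℕ := if j % (M+1) = M then 1 else a (j - j/(M+1))

lemma div_step (M n : ℕ) : (n % (M+1) = M → (n+1)/(M+1) = n/(M+1) + 1 ∧ (n+1) % (M+1) = 0) ∧
    (n % (M+1) ≠ M → (n+1)/(M+1) = n/(M+1)) := by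
  have h := Nat.div_add_mod n (M+1)
  have h2 := Nat.mod_lt n (show 0 < M+1 by omega)
  constructor
  · intro e
    have := (Nat.div_mod_unique (a := n+1) (c := 0) (d := n/(M+1)+1) (show 0 < M+1 by omega)).mpr
      ⟨by rw [mul_add]; omega, by omega⟩
    exact this
  · intro e
    have := (Nat.div_mod_unique (a := n+1) (c := n % (M+1) + 1) (d := n/(M+1))
      (show 0 < M+1 by omega)).mpr ⟨by omega, by omega⟩
    exact this.1

lemma sub_step (M n : ℕ) : (n % (M+1) = M → n + 1 - (n+1)/(M+1) = n - n/(M+1)) ∧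
    (n % (M+1) ≠ M → n + 1 - (n+1)/(M+1) = n - n/(M+1) + 1) := by
  have := Nat.div_le_self n (M+1)
  constructor
  · intro e; rw [((div_step M n).1 e).1]; omega
  · intro e; rw [((div_step M n).2 e)]; omega

lemma ins_pos {M : ℕ} {a : ℕ → ℕ} (ha : ∀ i, 1 ≤ a i) (j : ℕ) : 1 ≤ ins M a j := by
  unfold ins; split_ifs
  · exact le_rfl
  · exact ha _

lemma ins_sum (M : ℕ) (a : ℕ → ℕ) (n : ℕ) :
    ∑ j ∈ Finset.range n, (ins M a j : ℝ) =
      ∑ i ∈ Finset.range (n - n/(M+1)), (a i : ℝ) + (n/(M+1) : ℕ) := by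
  induction n with
  | zero => simp
  | succ n ih =>
    rw [Finset.sum_range_succ, ih]
    by_cases h : n % (M+1) = M
    · rw [(sub_step M n).1 h, ((div_step M n).1 h).1]
      simp [ins, h]; ring
    · rw [(sub_step M n).2 h, ((div_step M n).2 h), Finset.sum_range_succ]
      simp [ins, h]; ring

lemma ins_agree (M : ℕ) (a b : ℕ → ℕ) (n : ℕ) (h : ∀ j < n, ins M a j = ins M b j) :
    ∀ i < n - n/(M+1), a i = b i := by
  induction n with
  | zero => intro i hi; simp at hi
  | succ n ih =>
    have ih := ih (fun j hj => h j (by omega))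
    by_cases hM : n % (M+1) = M
    · rwa [(sub_step M n).1 hM]
    · rw [(sub_step M n).2 hM]
      intro i hi
      rcases Nat.lt_succ_iff_lt_or_eq.mp hi with h1 | h1
      · exact ih i h1
      · have := h n (by omega)
        simp only [ins, if_neg hM] at this
        rw [h1]; exact this

lemma half_le {M : ℕ} (hM : 1 ≤ M) (n : ℕ) : 2 * (n/(M+1)) ≤ n := by
  have := Nat.div_mul_le_self n (M+1)
  nlinarith

lemma ins_inj {M : ℕ} (hM : 1 ≤ M) {a b : ℕ → ℕ} (h : ins M a = ins M b) : a = b := by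
  funext i
  refine ins_agree M a b (2*i+2) (fun j _ => by rw [h]) i ?_
  have := half_le hM (2*i+2)
  omega

lemma ins_qq {M : ℕ} (hM : 1 ≤ M) {a : ℕ → ℕ} (ha : ∀ i, 1 ≤ a i) (n : ℕ) :
    ((qq (ins M a) n).2 ≤ 3^(n/(M+1)) * (qq a (n - n/(M+1))).2 ∧
      (qq (ins M a) n).1 ≤ 3^(n/(M+1)) * (qq a (n - n/(M+1))).1) ∨
    (n % (M+1) = 0 ∧ 3 * (qq (ins M a) n).2 ≤ 2 * (3^(n/(M+1)) * (qq a (n - n/(M+1))).2) ∧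
      3 * (qq (ins M a) n).1 ≤ 3^(n/(M+1)) * (qq a (n - n/(M+1))).2) := by
  induction n with
  | zero => left; simp [qq]
  | succ n ih =>
    obtain ⟨h1, h2, h3⟩ := qq_pos ha (n - n/(M+1))
    by_cases h : n % (M+1) = M
    · right
      obtain ⟨d1, d2⟩ := (div_step M n).1 h
      rcases ih with ⟨i1, i2⟩ | ⟨i1, -⟩
      swap
      · omega
      rw [(sub_step M n).1 h, d1]
      refine ⟨d2, ?_, ?_⟩
      · simp only [qq, ins, if_pos h]
        rw [pow_succ]
        have : (3:ℝ)^(n/(M+1)) * (qq a (n - n/(M+1))).1 ≤ (3:ℝ)^(n/(M+1)) * (qq a (n - n/(M+1))).2 := by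
          gcongr
        push_cast
        linarith
      · simp only [qq]
        rw [pow_succ]
        linarith
    · left
      rw [(sub_step M n).2 h, (div_step M n).2 h]
      simp only [qq]
      have hi : ins M a n = a (n - n/(M+1)) := by simp [ins, h]
      rw [hi]
      have hd : (1:ℝ) ≤ a (n - n/(M+1)) := by exact_mod_cast ha _
      set d : ℝ := ((a (n - n/(M+1)) : ℕ) : ℝ)
      set C : ℝ := 3^(n/(M+1))
      have hC : 0 < C := by positivity
      set q := (qq a (n - n/(M+1))).2
      set p := (qq a (n - n/(M+1))).1
      rcases ih with ⟨i1, i2⟩ | ⟨-, i1, i2⟩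
      · refine ⟨?_, i1⟩
        have := mul_le_mul_of_nonneg_left i1 (show 0 ≤ d by linarith)
        linarith
      · have hCq : 0 ≤ C * q := by positivity
        have hCp : 0 ≤ C * p := by positivity
        refine ⟨?_, by linarith⟩
        have := mul_le_mul_of_nonneg_left i1 (show 0 ≤ d by linarith)
        have := mul_le_mul_of_nonneg_right hd hCq
        linarith

lemma ins_qq' {M : ℕ} (hM : 1 ≤ M) {a : ℕ → ℕ} (ha : ∀ i, 1 ≤ a i) (n : ℕ) :
    (qq (ins M a) n).2 ≤ 3^(n/(M+1)) * (qq a (n - n/(M+1))).2 := by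
  obtain ⟨h1, h2, h3⟩ := qq_pos ha (n - n/(M+1))
  have : (0:ℝ) ≤ 3^(n/(M+1)) * (qq a (n - n/(M+1))).2 := by positivity
  rcases ins_qq hM ha n with h | h <;> linarith [h.1, h.2]

lemma poly_bound {α ρ : ℝ} (hα : 1 < α) (hρ : 1 < ρ) :
    ∃ C : ℝ, 0 ≤ C ∧ ∀ n : ℕ, 4 * (((n:ℝ)+3) * α + 2)^3 ≤ C * ρ^n := by
  have hρ0 : 0 < ρ := by linarith
  have lim := tendsto_pow_const_mul_const_pow_of_abs_lt_one 3 (r := ρ⁻¹)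
    (by rw [abs_of_pos (by positivity)]; exact inv_lt_one_of_one_lt₀ hρ)
  obtain ⟨K, hK⟩ := lim.bddAbove_range
  have hK' : ∀ n : ℕ, (n:ℝ)^3 ≤ K * ρ^n := by
    intro n
    have : (n:ℝ)^3 * ρ⁻¹^n ≤ K := hK ⟨n, rfl⟩
    rw [inv_pow, ← div_eq_mul_inv, div_le_iff₀ (by positivity)] at this
    exact this
  have hK0 : 0 ≤ K := by have := hK' 0; simpa using this
  refine ⟨4 * (α + 2)^3 * (K * ρ^3), by positivity, fun n => ?_⟩
  have h1 : ((n:ℝ)+3) * α + 2 ≤ (α + 2) * (n + 3) := by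
    have : (0:ℝ) ≤ n := by positivity
    linarith
  have h2 := hK' (n+3)
  push_cast at h2
  calc 4 * (((n:ℝ)+3) * α + 2)^3 ≤ 4 * ((α + 2) * (n + 3))^3 := by gcongr
    _ = 4 * (α+2)^3 * ((n:ℝ)+3)^3 := by ring
    _ ≤ 4 * (α+2)^3 * (K * ρ^(n+3)) := by gcongr
    _ = _ := by ring

lemma digit_bound {α x : ℝ} (hα : 1 < α) (hx : x ∈ Yset α) {i n : ℕ} (h : i + 1 ≤ n) :
    (cfPQ x i : ℝ) ≤ n * α := by
  have h1 := hx.2.2 (i+1) (by omega)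
  have h2 : (cfPQ x i : ℝ) ≤ ∑ j ∈ Finset.range (i+1), (cfPQ x j : ℝ) :=
    Finset.single_le_sum (f := fun j => (cfPQ x j : ℝ)) (fun j _ => by positivity) (by simp)
  refine h2.trans (h1.le.trans ?_)
  have : ((i+1 : ℕ):ℝ) ≤ n := by exact_mod_cast h
  gcongr

lemma ins_mem_X {α x z : ℝ} (hα : 1 < α) (hx : x ∈ Yset α) (hz : Good z) (M : ℕ)
    (h : cfPQ z = ins M (cfPQ x)) : z ∈ Xset α := by
  refine ⟨hz.1, hz.2, ?_⟩
  have hM : (0:ℝ) < M + 1 := by positivity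
  set β : ℝ := α - (α - 1) / (2 * (M+1)) with hβ
  have hlt : β < α := by
    have : 0 < (α - 1) / (2 * ((M:ℝ)+1)) := div_pos (by linarith) (by positivity)
    linarith
  refine lt_of_le_of_lt ?_ ((ENNReal.ofReal_lt_ofReal_iff (by linarith)).mpr hlt)
  refine limsup_le_of_le (by isBoundedDefault) ?_
  filter_upwards [eventually_ge_atTop (2 * (M+1))] with n hn
  apply ENNReal.ofReal_le_ofReal
  have hn0 : (0:ℝ) < n := by
    have : 0 < n := by omega
    exact_mod_cast this
  rw [div_le_iff₀ hn0, h, ins_sum]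
  have hs : ∑ i ∈ Finset.range (n - n/(M+1)), (cfPQ x i : ℝ) ≤ ((n - n/(M+1) : ℕ) : ℝ) * α := by
    rcases Nat.eq_zero_or_pos (n - n/(M+1)) with h0 | h0
    · rw [h0]; simp
    · exact (hx.2.2 _ h0).le
  rw [Nat.cast_sub (Nat.div_le_self _ _)] at hs
  have hc : (n:ℝ) / (2 * (M+1)) ≤ (n/(M+1) : ℕ) := by
    rw [div_le_iff₀ (by positivity)]
    have h1 := Nat.div_add_mod n (M+1)
    have h2 := Nat.mod_lt n (show 0 < M+1 by omega)
    have h3 : 1 ≤ n/(M+1) := (Nat.one_le_div_iff (by omega)).mpr (by omega)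
    have : n ≤ n/(M+1) * (2 * (M+1)) := by nlinarith
    exact_mod_cast this
  have e : β * n = n * α - (α - 1) * (n / (2 * (M+1))) := by rw [hβ]; ring
  rw [e]
  have := mul_le_mul_of_nonneg_left hc (show 0 ≤ α - 1 by linarith)
  linarith

lemma eq_of_digits {x y : ℝ} (hx : Good x) (hy : Good y) (h : cfPQ x = cfPQ y) : x = y := by
  have b : ∀ n : ℕ, |x - y| ≤ 2 * (2⁻¹)^n := by
    intro n
    have u := dist_upper hx hy n (fun i _ => by rw [h])
    have g := qq_growth hx.one_le n
    obtain ⟨h1, h2, h3⟩ := qq_pos hx.one_le n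
    set q := (qq (cfPQ x) n).2
    set p := (qq (cfPQ x) n).1
    have g2 : (2:ℝ)^n ≤ 2 * q^2 := by nlinarith
    rw [inv_pow, ← div_eq_mul_inv, le_div_iff₀ (by positivity)]
    calc |x - y| * 2^n ≤ |x - y| * (2 * q^2) := by gcongr
      _ ≤ 2 := by linarith
  have lim : Tendsto (fun n : ℕ => 2 * ((2:ℝ)⁻¹)^n) atTop (nhds (2 * 0)) :=
    (tendsto_pow_atTop_nhds_zero_of_lt_one (by norm_num) (by norm_num)).const_mul 2
  have := ge_of_tendsto' lim b
  rw [mul_zero] at this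
  linarith [abs_nonpos_iff.mp this]

lemma dim_Y_eps {α : ℝ} (hα : 1 < α) {ε : ℝ} (hε : 0 < ε) :
    ENNReal.ofReal (1 / (1+ε)) * dimH (Yset α) ≤ dimH (Xset α) := by
  obtain ⟨M, hM⟩ := exists_nat_ge (16 / ε + 1)
  have hM1 : 1 ≤ M := by
    have : (1:ℝ) ≤ M := le_trans (by have : 0 < 16/ε := by positivity
                                     linarith) hM
    exact_mod_cast this
  have hM2 : 16 / ε ≤ (M:ℝ) + 1 := by linarith
  set ρ : ℝ := 2 ^ (ε/4) with hρ
  have hρ1 : 1 < ρ := Real.one_lt_rpow (by norm_num) (by positivity)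
  obtain ⟨C, hC, hpoly⟩ := poly_bound hα hρ1
  have ex : ∀ x : ℝ, ∃ z, x ∈ Yset α → Good z ∧ cfPQ z = ins M (cfPQ x) := by
    intro x
    by_cases hx : x ∈ Yset α
    · have hg : Good x := ⟨hx.1, hx.2.1⟩
      obtain ⟨z, hz, hzz⟩ := exists_cf (ins_pos (M := M) hg.one_le)
      exact ⟨z, fun _ => ⟨hz, funext hzz⟩⟩
    · exact ⟨0, fun h => absurd h hx⟩
  choose k hk using ex
  refine dimH_anti k (fun x hx => ins_mem_X hα hx (hk x hx).1 M (hk x hx).2)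
    ((C * 2 ^ ε) ^ (1/(1+ε))) (1/(1+ε)) (by positivity) (by positivity) ?_
  intro x hx y hy
  have gx : Good x := ⟨hx.1, hx.2.1⟩
  have gy : Good y := ⟨hy.1, hy.2.1⟩
  obtain ⟨zx, ex⟩ := hk x hx
  obtain ⟨zy, ey⟩ := hk y hy
  by_cases hab : cfPQ (k x) = cfPQ (k y)
  · have : x = y := eq_of_digits gx gy (ins_inj hM1 (by rw [← ex, ← ey, hab]))
    rw [this, sub_self, abs_zero]; positivity
  obtain ⟨n, hn, hne⟩ := first_diff hab
  have hbound : ∀ w ∈ Yset α, ∀ i < 3, (ins M (cfPQ w) (n+i) : ℝ) ≤ ((n:ℝ)+3) * α := by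
    intro w hw i hi
    unfold ins
    split_ifs
    · have : (0:ℝ) ≤ n := by positivity
      push_cast
      nlinarith
    · have := Nat.div_le_self (n+i) (M+1)
      have := digit_bound hα hw (i := n + i - (n+i)/(M+1)) (n := n+3)
        (by have := Nat.sub_le (n+i) ((n+i)/(M+1)); omega)
      exact_mod_cast this
  have lo := dist_lower (B := ((n:ℝ)+3) * α) zx zy n hn hne
    (by rw [ex]; exact hbound x hx) (by rw [ey]; exact hbound y hy)
  have hag : ∀ i < n - n/(M+1), cfPQ x i = cfPQ y i :=
    ins_agree M _ _ n (by rw [← ex, ← ey]; exact hn)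
  have up := dist_upper gx gy _ hag
  have cmp := ins_qq' hM1 gx.one_le n
  rw [← ex] at cmp
  have gr := qq_growth gx.one_le (n - n/(M+1))
  obtain ⟨h1, h2, h3⟩ := qq_pos gx.one_le (n - n/(M+1))
  obtain ⟨H1, H2, H3⟩ := qq_pos zx.one_le n
  have hal := half_le hM1 n
  have hcM : ((n/(M+1) : ℕ):ℝ) ≤ n * ε / 16 := by
    have h5 : ((n/(M+1) : ℕ):ℝ) ≤ n / ((M+1 : ℕ):ℝ) := Nat.cast_div_le
    push_cast at h5
    refine h5.trans ?_
    rw [div_le_iff₀ (by positivity)]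
    rw [div_le_iff₀ hε] at hM2
    have : (0:ℝ) ≤ n := by positivity
    nlinarith
  set c := n/(M+1)
  set q := (qq (cfPQ x) (n - c)).2
  set p := (qq (cfPQ x) (n - c)).1
  set Q := (qq (cfPQ (k x)) n).2
  set D := |k x - k y|
  have q2 : (2:ℝ)^(n - c) ≤ 2 * q^2 := by nlinarith
  -- `9^c ≤ ρ^n`
  have nine : (3:ℝ)^c * 3^c ≤ ρ^n := by
    calc (3:ℝ)^c * 3^c ≤ 4^c * 4^c := by gcongr <;> norm_num
      _ = (2:ℝ) ^ (4 * (c:ℝ)) := by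
        rw [← mul_pow, show (4:ℝ)*4 = 2^4 by norm_num, ← pow_mul, ← Real.rpow_natCast]
        push_cast; rfl
      _ ≤ (2:ℝ) ^ (ε/4 * n) := by
        apply Real.rpow_le_rpow_of_exponent_le (by norm_num); linarith
      _ = ρ^n := by rw [hρ, Real.rpow_mul (by norm_num), Real.rpow_natCast]
  have rho2 : ρ^n * ρ^n ≤ 2^ε * (q^2)^ε := by
    have e1 : ρ^n * ρ^n = (2:ℝ) ^ (ε/2 * n) := by
      rw [← mul_pow, hρ, ← Real.rpow_add (by norm_num), Real.rpow_mul (by norm_num), Real.rpow_natCast]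
      congr 2; ring
    rw [e1, ← Real.mul_rpow (by norm_num) (by positivity)]
    have hnc : (n:ℝ)/2 ≤ ((n - c : ℕ):ℝ) := by
      rw [Nat.cast_sub (by omega)]
      have : (2:ℝ) * c ≤ n := by exact_mod_cast hal
      linarith
    calc (2:ℝ) ^ (ε/2 * n) ≤ (2:ℝ) ^ (((n - c : ℕ):ℝ) * ε) := by
          apply Real.rpow_le_rpow_of_exponent_le (by norm_num); nlinarith
      _ = ((2:ℝ)^(n-c)) ^ ε := by rw [Real.rpow_mul (by norm_num), Real.rpow_natCast]
      _ ≤ _ := Real.rpow_le_rpow (by positivity) q2 hε.le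
  have hD : 0 ≤ D := abs_nonneg _
  have hq0 : 0 < q := by linarith
  have main : 1 ≤ C * 2^ε * (q^2)^(1+ε) * D := by
    have hB : 0 ≤ ((n:ℝ)+3) * α + 2 := by positivity
    calc (1:ℝ) ≤ 4 * Q^2 * (((n:ℝ)+3) * α + 2)^3 * D := lo
      _ ≤ 4 * (3^c * q)^2 * (((n:ℝ)+3) * α + 2)^3 * D := by gcongr
      _ = (4 * (((n:ℝ)+3) * α + 2)^3) * (3^c * 3^c) * q^2 * D := by ring
      _ ≤ (C * ρ^n) * ρ^n * q^2 * D := by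
        have := mul_le_mul (hpoly n) nine (by positivity) (by positivity)
        gcongr
      _ = C * (ρ^n * ρ^n) * q^2 * D := by ring
      _ ≤ C * (2^ε * (q^2)^ε) * q^2 * D := by gcongr
      _ = _ := by rw [Real.rpow_add (by positivity), Real.rpow_one]; ring
  rw [← Real.mul_rpow (by positivity) hD]
  have hu : 0 ≤ |x - y| := abs_nonneg _
  set u := |x - y|
  have fin : u^(1+ε) ≤ C * 2^ε * D := by
    calc u^(1+ε) = u^(1+ε) * 1 := by ring
      _ ≤ u^(1+ε) * (C * 2^ε * (q^2)^(1+ε) * D) := by gcongr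
      _ = (u * q^2)^(1+ε) * (C * 2^ε * D) := by
        rw [Real.mul_rpow hu (by positivity)]; ring
      _ ≤ 1 * (C * 2^ε * D) := by
        gcongr
        exact Real.rpow_le_one (by positivity) up (by positivity)
      _ = _ := by ring
  calc u = (u^(1+ε))^(1/(1+ε)) := by
        rw [← Real.rpow_mul hu, mul_one_div_cancel (by positivity), Real.rpow_one]
    _ ≤ _ := Real.rpow_le_rpow (by positivity) fin (by positivity)

lemma dim_Y_le {α : ℝ} (hα : 1 < α) : dimH (Yset α) ≤ dimH (Xset α) := by
  have l1 : Tendsto (fun n : ℕ => 1 / (1 + 1 / ((n:ℝ) + 1))) atTop (nhds 1) := by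
    have := (tendsto_one_div_add_atTop_nhds_zero_nat (𝕜 := ℝ)).const_add 1
    have := this.inv₀ (by norm_num)
    simpa using this
  have l2 := ENNReal.tendsto_ofReal l1
  have l3 := ENNReal.Tendsto.mul_const (b := dimH (Yset α)) l2 (Or.inl (by simp))
  rw [ENNReal.ofReal_one, one_mul] at l3
  exact le_of_tendsto' l3 fun n => dim_Y_eps hα (by positivity)

/-- For every `α > 1`, `dim_H X_α = dim_H Y_α`, and this common value
tends to `1` as `α → ∞`. -/
theorem stmt19 :
    (∀ α : ℝ, 1 < α → dimH (Xset α) = dimH (Yset α)) ∧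
    Filter.Tendsto (fun α : ℝ => dimH (Xset α)) Filter.atTop (nhds 1) :=
  ⟨fun α hα => le_antisymm (dim_X_le α) (dim_Y_le hα), X_tendsto⟩
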